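/- arXiv:1503.08898 — 2 statements merged into one kernel-verified Lean document; each statement's English description precedes it below -/
import Mathlib

section
/- Let P be a finite ranked poset and p ∈ P. The toggleability statistic T_p is 0-mesic with respect to gyration: for every orbit O of gyr acting on J(P), the sum of T_p(I) over all I ∈ O equals 0. -/
open scoped Classical

/-- The set of order ideals (lower sets) of a poset `P`. -/
abbrev OrderIdeal (P : Type*) [PartialOrder P] := {I : Set P // IsLowerSet I}

variable {P : Type*} [PartialOrder P]

/-- The toggle `t_p : J(P) → J(P)`: it adds `p` if `p` is a minimal element of the
complement of `I`, removes `p` if `p` is a maximal element of `I`, and otherwise fixes `I`. -/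
noncomputable def toggle (p : P) (I : OrderIdeal P) : OrderIdeal P :=
  if h₁ : p ∉ I.1 ∧ ∀ q, q < p → q ∈ I.1 then
    ⟨I.1 ∪ {p}, by
      intro a b hba ha
      rcases ha with ha | ha
      · exact Or.inl (I.2 hba ha)
      · rw [Set.mem_singleton_iff] at ha
        subst ha
        rcases eq_or_lt_of_le hba with h | h
        · exact Or.inr (by rw [Set.mem_singleton_iff]; exact h)
        · exact Or.inl (h₁.2 b h)⟩
  else if h₂ : p ∈ I.1 ∧ ∀ q, p < q → q ∉ I.1 then
    ⟨I.1 \ {p}, by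
      intro a b hba ha
      refine ⟨I.2 hba ha.1, ?_⟩
      intro hb
      rw [Set.mem_singleton_iff] at hb
      subst hb
      rcases eq_or_lt_of_le hba with h | h
      · exact ha.2 (by rw [Set.mem_singleton_iff]; exact h.symm)
      · exact h₂.2 a h ha.1⟩
  else I

/-- Rowmotion: `I` is sent to the order ideal generated by the minimal elements of `P∖I`. -/
noncomputable def rowmotion (I : OrderIdeal P) : OrderIdeal P :=
  ⟨{x | ∃ m, m ∉ I.1 ∧ (∀ q, q < m → q ∈ I.1) ∧ x ≤ m}, by
    intro a b hba ha
    obtain ⟨m, h1, h2, h3⟩ := ha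
    exact ⟨m, h1, h2, hba.trans h3⟩⟩

/-- The toggleability statistic `T_p`. -/
noncomputable def togStat (p : P) (I : OrderIdeal P) : ℤ :=
  if p ∉ I.1 ∧ ∀ q, q < p → q ∈ I.1 then 1
  else if p ∈ I.1 ∧ ∀ q, p < q → q ∉ I.1 then -1
  else 0


/-- Gyration: first toggle all elements of even rank, then all elements of odd rank.
(Toggles at distinct elements whose ranks have equal parity commute, so this is
independent of the order chosen within each parity class.) -/
noncomputable def gyration [Fintype P] (rk : P → ℕ) : OrderIdeal P → OrderIdeal P :=
  (((Finset.univ.filter fun p : P => rk p % 2 = 1).toList.map toggle).foldr (· ∘ ·) id) ∘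
    (((Finset.univ.filter fun p : P => rk p % 2 = 0).toList.map toggle).foldr (· ∘ ·) id)


theorem mem_toggle_ne {p q : P} (h : p ≠ q) (I : OrderIdeal P) :
    p ∈ (toggle q I).1 ↔ p ∈ I.1 := by
  unfold toggle
  split_ifs <;> simp [h]

theorem all_lt_iff [Fintype P] (p : P) (I : OrderIdeal P) :
    (∀ q, q < p → q ∈ I.1) ↔ ∀ q, q ⋖ p → q ∈ I.1 := by
  constructor
  · exact fun h q hq => h q hq.lt
  · intro h q hq
    obtain ⟨r, hr, hrp⟩ := exists_le_covBy_of_lt hq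
    exact I.2 hr (h r hrp)

theorem all_gt_iff [Fintype P] (p : P) (I : OrderIdeal P) :
    (∀ q, p < q → q ∉ I.1) ↔ ∀ q, p ⋖ q → q ∉ I.1 := by
  constructor
  · exact fun h q hq => h q hq.lt
  · intro h q hq hI
    obtain ⟨r, hr, hrp⟩ := exists_covBy_le_of_lt hq
    exact h r hr (I.2 hrp hI)

theorem togStat_congr [Fintype P] (p : P) (I J : OrderIdeal P) (h0 : p ∈ I.1 ↔ p ∈ J.1)
    (h1 : ∀ q, q ⋖ p → (q ∈ I.1 ↔ q ∈ J.1)) (h2 : ∀ q, p ⋖ q → (q ∈ I.1 ↔ q ∈ J.1)) :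
    togStat p I = togStat p J := by
  have a1 : (∀ q, q ⋖ p → q ∈ I.1) ↔ ∀ q, q ⋖ p → q ∈ J.1 :=
    forall_congr' fun q => forall_congr' fun hq => h1 q hq
  have a2 : (∀ q, p ⋖ q → q ∉ I.1) ↔ ∀ q, p ⋖ q → q ∉ J.1 :=
    forall_congr' fun q => forall_congr' fun hq => not_congr (h2 q hq)
  unfold togStat
  simp only [all_lt_iff, all_gt_iff, h0, a1, a2]

noncomputable def indP (p : P) (I : OrderIdeal P) : ℤ := if p ∈ I.1 then 1 else 0

theorem toggle_self (p : P) (I : OrderIdeal P) :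
    indP p (toggle p I) = indP p I + togStat p I ∧ togStat p (toggle p I) = - togStat p I := by
  by_cases h1 : p ∉ I.1 ∧ ∀ q, q < p → q ∈ I.1
  · have e : (toggle p I).1 = I.1 ∪ {p} := by unfold toggle; rw [dif_pos h1]
    have m : p ∈ (toggle p I).1 := by rw [e]; simp
    have n : ∀ q, p < q → q ∉ (toggle p I).1 := by
      intro q hq hm
      rw [e] at hm
      rcases hm with hm | hm
      · exact h1.1 (I.2 hq.le hm)
      · exact hq.ne' hm
    have s : togStat p I = 1 := if_pos h1
    have s' : togStat p (toggle p I) = -1 := by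
      unfold togStat; rw [if_neg (fun h => h.1 m), if_pos ⟨m, n⟩]
    refine ⟨?_, by rw [s, s']⟩
    rw [s]; unfold indP; rw [if_pos m, if_neg h1.1]; rfl
  by_cases h2 : p ∈ I.1 ∧ ∀ q, p < q → q ∉ I.1
  · have e : (toggle p I).1 = I.1 \ {p} := by unfold toggle; rw [dif_neg h1, dif_pos h2]
    have m : p ∉ (toggle p I).1 := by rw [e]; simp
    have n : ∀ q, q < p → q ∈ (toggle p I).1 := by
      intro q hq
      rw [e]
      exact ⟨I.2 hq.le h2.1, hq.ne⟩
    have s : togStat p I = -1 := by unfold togStat; rw [if_neg h1, if_pos h2]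
    have s' : togStat p (toggle p I) = 1 := if_pos ⟨m, n⟩
    refine ⟨?_, by rw [s, s']; rfl⟩
    rw [s]; unfold indP; rw [if_neg m, if_pos h2.1]; rfl
  · have e : toggle p I = I := by unfold toggle; rw [dif_neg h1, dif_neg h2]
    have s : togStat p I = 0 := by unfold togStat; rw [if_neg h1, if_neg h2]
    rw [e, s]; simp

theorem toggle_injective (p : P) : Function.Injective (toggle p) := by
  intro I J h
  have hm : p ∈ I.1 ↔ p ∈ J.1 := by
    have a := toggle_self p I
    have b := toggle_self p J
    rw [h] at a
    have : indP p I = indP p J := by linarith [a.1, a.2, b.1, b.2]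
    unfold indP at this
    split_ifs at this <;> simp_all
  apply Subtype.ext
  ext q
  by_cases hq : q = p
  · rw [hq]; exact hm
  · rw [← mem_toggle_ne hq I, h, mem_toggle_ne hq J]

noncomputable def togs (l : List P) : OrderIdeal P → OrderIdeal P :=
  (l.map toggle).foldr (· ∘ ·) id

theorem togs_cons (a : P) (l : List P) (I : OrderIdeal P) :
    togs (a :: l) I = toggle a (togs l I) := rfl

theorem togs_injective (l : List P) : Function.Injective (togs l) := by
  induction l with
  | nil => exact Function.injective_id
  | cons a l ih => exact (toggle_injective a).comp ih

theorem mem_togs {p : P} (l : List P) (h : p ∉ l) (I : OrderIdeal P) :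
    p ∈ (togs l I).1 ↔ p ∈ I.1 := by
  induction l with
  | nil => rfl
  | cons a l ih =>
    rw [List.mem_cons, not_or] at h
    rw [togs_cons, mem_toggle_ne h.1, ih h.2]

theorem togStat_togs_notMem [Fintype P] {rk : P → ℕ}
    (hrk : ∀ p q : P, q ⋖ p → rk p = rk q + 1) {p : P} (l : List P) (h : p ∉ l)
    (hl : ∀ q ∈ l, rk q % 2 = rk p % 2) (I : OrderIdeal P) :
    togStat p (togs l I) = togStat p I := by
  apply togStat_congr
  · exact mem_togs l h I
  · intro q hq
    refine mem_togs l (fun hm => ?_) I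
    have := hl q hm
    have := hrk _ _ hq
    omega
  · intro q hq
    refine mem_togs l (fun hm => ?_) I
    have := hl q hm
    have := hrk _ _ hq
    omega

theorem togs_mem [Fintype P] {rk : P → ℕ}
    (hrk : ∀ p q : P, q ⋖ p → rk p = rk q + 1) {p : P} (l : List P) (hn : l.Nodup) (h : p ∈ l)
    (hl : ∀ q ∈ l, rk q % 2 = rk p % 2) (I : OrderIdeal P) :
    indP p (togs l I) = indP p I + togStat p I ∧ togStat p (togs l I) = - togStat p I := by
  induction l with
  | nil => simp at h
  | cons a l ih =>
    rw [List.nodup_cons] at hn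
    have hl' : ∀ q ∈ l, rk q % 2 = rk p % 2 := fun q hq => hl q (List.mem_cons_of_mem _ hq)
    rw [togs_cons]
    by_cases hp : p = a
    · subst hp
      have h1 := toggle_self p (togs l I)
      rw [togStat_togs_notMem hrk l hn.1 hl'] at h1
      have h2 : indP p (togs l I) = indP p I := by
        unfold indP; simp only [mem_togs l hn.1]
      rwa [h2] at h1
    · have hpl : p ∈ l := (List.mem_cons.1 h).resolve_left hp
      have h1 := ih hn.2 hpl hl'
      have h2 : indP p (toggle a (togs l I)) = indP p (togs l I) := by
        unfold indP; simp only [mem_toggle_ne hp]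
      have h3 : togStat p (toggle a (togs l I)) = togStat p (togs l I) :=
        togStat_togs_notMem hrk [a] (by simpa using hp)
          (by simpa using hl a List.mem_cons_self) (togs l I)
      rw [h2, h3]; exact h1

theorem sum_orbit_comp {α : Type*} [Fintype α] (g : α → α) (hg : Function.Injective g) (x : α)
    (f : α → ℤ) :
    ∑ J ∈ Finset.univ.filter (fun J => ∃ k : ℕ, g^[k] x = J), f (g J) =
    ∑ J ∈ Finset.univ.filter (fun J => ∃ k : ℕ, g^[k] x = J), f J := by
  set S := Finset.univ.filter (fun J => ∃ k : ℕ, g^[k] x = J) with hS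
  have hsub : S.image g ⊆ S := by
    intro y hy
    obtain ⟨z, hz, rfl⟩ := Finset.mem_image.1 hy
    obtain ⟨k, rfl⟩ := (Finset.mem_filter.1 hz).2
    exact Finset.mem_filter.2 ⟨Finset.mem_univ _, k + 1, Function.iterate_succ_apply' g k x⟩
  have him : S.image g = S :=
    Finset.eq_of_subset_of_card_le hsub (Finset.card_image_of_injective S hg).ge
  conv_rhs => rw [← him]
  rw [Finset.sum_image (fun a _ b _ h => hg h)]

/-- For any finite ranked poset `P` and `p ∈ P`, the toggleability statistic `T_p` is
0-mesic with respect to gyration: the sum of `T_p` over every orbit of `gyr` on `J(P)`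
is `0`. (The orbit of `I` is the set of all iterates of `I` under `gyr`.) -/
theorem stmt_8 [Fintype P] (rk : P → ℕ) (hrk : ∀ p q : P, q ⋖ p → rk p = rk q + 1)
    (p : P) (I : OrderIdeal P) :
    ∑ J ∈ Finset.univ.filter (fun J => ∃ k : ℕ, (gyration rk)^[k] I = J), togStat p J = 0 := by
  set lo := (Finset.univ.filter fun p : P => rk p % 2 = 1).toList with hlo
  set le := (Finset.univ.filter fun p : P => rk p % 2 = 0).toList with hle
  have hgy : gyration rk = togs lo ∘ togs le := rfl
  have hinj : Function.Injective (gyration rk) := by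
    rw [hgy]; exact (togs_injective _).comp (togs_injective _)
  have mo : ∀ q, q ∈ lo ↔ rk q % 2 = 1 := fun q => by simp [hlo]
  have me : ∀ q, q ∈ le ↔ rk q % 2 = 0 := fun q => by simp [hle]
  have hf := sum_orbit_comp (gyration rk) hinj I (indP p)
  rcases Nat.mod_two_eq_zero_or_one (rk p) with h | h
  · have key : ∀ J, togStat p J = indP p (gyration rk J) - indP p J := by
      intro J
      have h1 := togs_mem hrk le (Finset.nodup_toList _) ((me p).2 h)
        (fun q hq => ((me q).1 hq).trans h.symm) J
      have h2 : indP p (gyration rk J) = indP p (togs le J) := by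
        rw [hgy]; unfold indP
        simp only [Function.comp, mem_togs lo (fun hm => by have := (mo p).1 hm; omega)]
      rw [h2, h1.1]; ring
    rw [Finset.sum_congr rfl (fun J _ => key J), Finset.sum_sub_distrib, hf, sub_self]
  · have key : ∀ J, togStat p (gyration rk J) = indP p J - indP p (gyration rk J) := by
      intro J
      have h1 := togs_mem hrk lo (Finset.nodup_toList _) ((mo p).2 h)
        (fun q hq => ((mo q).1 hq).trans h.symm) (togs le J)
      have h2 : indP p (togs le J) = indP p J := by
        unfold indP
        simp only [mem_togs le (fun hm => by have := (me p).1 hm; omega)]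
      rw [hgy, Function.comp, h1.1, h1.2, h2]; ring
    rw [← sum_orbit_comp (gyration rk) hinj I (togStat p),
      Finset.sum_congr rfl (fun J _ => key J), Finset.sum_sub_distrib, hf, sub_self]
end

section
/- Let P be a finite ranked poset, p ∈ P with rk(p) even, and I ∈ J(P) with T_p(I) = 0. If p ∈ I, then either T_p(gyr(I)) = −1, or T_p(gyr(I)) = 0 and p ∈ gyr(I); in particular T_p(gyr(I)) ≠ 1. If p ∉ I, then either T_p(gyr(I)) = 1, or T_p(gyr(I)) = 0 and p ∉ gyr(I); in particular T_p(gyr(I)) ≠ −1. -/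
open scoped Classical

variable {P : Type*} [PartialOrder P]

theorem ideal_down (J : OrderIdeal P) {a b : P} (h : b ≤ a) (ha : a ∈ J.1) : b ∈ J.1 :=
  J.2 h ha

theorem mem_toggle_of_ne {r p : P} (h : r ≠ p) (I : OrderIdeal P) :
    r ∈ (toggle p I).1 ↔ r ∈ I.1 := by
  unfold toggle
  split_ifs <;> simp [h]

theorem mem_foldr_toggle {r : P} (l : List P) (h : r ∉ l) (I : OrderIdeal P) :
    r ∈ (((l.map toggle).foldr (· ∘ ·) id) I).1 ↔ r ∈ I.1 := by
  induction l with
  | nil => simp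
  | cons a l ih =>
    simp only [List.mem_cons, not_or] at h
    simp only [List.map_cons, List.foldr_cons, Function.comp_apply]
    rw [mem_toggle_of_ne h.1]
    exact ih h.2

/-- Let `P` be a finite ranked poset, `p` of even rank, `I ∈ J(P)` with `T_p(I) = 0`.
If `p ∈ I` then `T_p(gyr(I)) = -1`, or `T_p(gyr(I)) = 0` and `p ∈ gyr(I)`; in particular
`T_p(gyr(I)) ≠ 1`. If `p ∉ I` then `T_p(gyr(I)) = 1`, or `T_p(gyr(I)) = 0` and
`p ∉ gyr(I)`; in particular `T_p(gyr(I)) ≠ -1`. -/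
theorem stmt_10 [Fintype P] (rk : P → ℕ) (hrk : ∀ p q : P, q ⋖ p → rk p = rk q + 1)
    (p : P) (hp : rk p % 2 = 0) (I : OrderIdeal P) (h0 : togStat p I = 0) :
    (p ∈ I.1 →
      ((togStat p (gyration rk I) = -1 ∨
        (togStat p (gyration rk I) = 0 ∧ p ∈ (gyration rk I).1)) ∧
        togStat p (gyration rk I) ≠ 1)) ∧
    (p ∉ I.1 →
      ((togStat p (gyration rk I) = 1 ∨
        (togStat p (gyration rk I) = 0 ∧ p ∉ (gyration rk I).1)) ∧
        togStat p (gyration rk I) ≠ -1)) := by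
  have hodd : ∀ J : OrderIdeal P, p ∈ (((((Finset.univ.filter
      fun p : P => rk p % 2 = 1).toList.map toggle).foldr (· ∘ ·) id)) J).1 ↔ p ∈ J.1 :=
    fun J => mem_foldr_toggle _ (by simp [hp]) J
  have heven : ∀ r : P, rk r % 2 = 1 → (r ∈ (((((Finset.univ.filter
      fun p : P => rk p % 2 = 0).toList.map toggle).foldr (· ∘ ·) id)) I).1 ↔ r ∈ I.1) :=
    fun r hr => mem_foldr_toggle _ (by simp [hr]) I
  constructor
  · intro hpI
    have hmem : p ∈ (gyration rk I).1 := by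
      have h1 : ∃ q, p < q ∧ q ∈ I.1 := by
        by_contra hc
        push Not at hc
        have h2 : p ∈ I.1 ∧ ∀ q, p < q → q ∉ I.1 := ⟨hpI, hc⟩
        unfold togStat at h0
        rw [if_neg (fun h => h.1 hpI), if_pos h2] at h0
        omega
      obtain ⟨q, hpq, hq⟩ := h1
      obtain ⟨c, hpc, hcq⟩ := exists_covBy_le_of_lt hpq
      have hr := hrk c p hpc
      unfold gyration
      rw [Function.comp_apply, hodd]
      exact ideal_down _ hpc.le ((heven c (by omega)).2 (I.2 hcq hq))
    generalize gyration rk I = K at hmem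
    unfold togStat
    split_ifs <;> simp_all
  · intro hpI
    have hmem : p ∉ (gyration rk I).1 := by
      have h1 : ∃ q, q < p ∧ q ∉ I.1 := by
        by_contra hc
        push Not at hc
        have h2 : p ∉ I.1 ∧ ∀ q, q < p → q ∈ I.1 := ⟨hpI, hc⟩
        unfold togStat at h0
        rw [if_pos h2] at h0
        omega
      obtain ⟨q, hqp, hq⟩ := h1
      obtain ⟨c, hqc, hcp⟩ := exists_le_covBy_of_lt hqp
      have hr := hrk p c hcp
      unfold gyration
      rw [Function.comp_apply, hodd]
      intro hm
      exact hq (I.2 hqc ((heven c (by omega)).1 (ideal_down _ hcp.le hm)))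
    generalize gyration rk I = K at hmem
    unfold togStat
    split_ifs <;> simp_all
end
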